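/- Let (g, θ) be a real symmetric Lie algebra and let g* = {Z ∈ g(ℂ) : σ*(Z) = Z} be its dual real form. Then there exist an algebraic family of complex Lie algebras 𝔤 over the affine line and an anti-holomorphic involution σ̂ of 𝔤 such that, writing 𝔤^σ̂ = {X ∈ 𝔤 : σ̂(X) = X} (a Lie algebra over ℝ[z]) and, for each α ∈ ℝ, 𝔤^σ̂|_α for the quotient real Lie algebra 𝔤^σ̂ / ((z−α)•𝔤^σ̂), one has: 𝔤^σ̂|_α ≅ g* as real Lie algebras when α < 0; 𝔤^σ̂|_α ≅ (g, [·,·]₀^{g^θ, g^{-θ}}) when α = 0; and 𝔤^σ̂|_α ≅ g when α > 0. -/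

import Mathlib

open scoped TensorProduct

open Polynomial

/-- An algebraic family of complex Lie algebras over the affine line `𝔸¹_ℂ`:
a Lie algebra over the polynomial ring `ℂ[z]` whose underlying module is free of
finite rank. -/
structure AlgebraicFamilyOfComplexLieAlgebras where
  carrier : Type
  [lieRing : LieRing carrier]
  [lieAlgebra : LieAlgebra (Polynomial ℂ) carrier]
  [free : Module.Free (Polynomial ℂ) carrier]
  [finite : Module.Finite (Polynomial ℂ) carrier]

attribute [instance] AlgebraicFamilyOfComplexLieAlgebras.lieRing
  AlgebraicFamilyOfComplexLieAlgebras.lieAlgebra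
  AlgebraicFamilyOfComplexLieAlgebras.free
  AlgebraicFamilyOfComplexLieAlgebras.finite

/-- The ℂ-linear extension `θ̃` of a real Lie algebra automorphism `θ` to the
complexification `g(ℂ) = ℂ ⊗[ℝ] g`. -/
noncomputable def thetaC {g : Type*} [LieRing g] [LieAlgebra ℝ g] (θ : g ≃ₗ⁅ℝ⁆ g) :
    ℂ ⊗[ℝ] g →ₗ[ℂ] ℂ ⊗[ℝ] g :=
  LinearMap.baseChange ℂ θ.toLinearEquiv.toLinearMap

/-- The conjugate-linear involution `σ` of `g(ℂ) = ℂ ⊗[ℝ] g` determined by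
`σ(a ⊗ X) = conj(a) ⊗ X`. -/
noncomputable def sigmaC (g : Type*) [AddCommGroup g] [Module ℝ g] :
    ℂ ⊗[ℝ] g →ₗ[ℝ] ℂ ⊗[ℝ] g :=
  LinearMap.rTensor g Complex.conjAe.toLinearMap

/-- The projection of `g` onto `g^θ` along `g^{−θ}`, namely `(1 + θ)/2`. -/
noncomputable def prTheta {g : Type*} [LieRing g] [LieAlgebra ℝ g] (θ : g ≃ₗ⁅ℝ⁆ g) :
    g →ₗ[ℝ] g :=
  (1/2 : ℝ) • (LinearMap.id + θ.toLinearEquiv.toLinearMap)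

/-- The projection of `g` onto `g^{−θ}` along `g^θ`, namely `(1 − θ)/2`. -/
noncomputable def prThetaMinus {g : Type*} [LieRing g] [LieAlgebra ℝ g] (θ : g ≃ₗ⁅ℝ⁆ g) :
    g →ₗ[ℝ] g :=
  (1/2 : ℝ) • (LinearMap.id - θ.toLinearEquiv.toLinearMap)

/-- The contracted (Inönü–Wigner) bracket `[·,·]₀^{g^θ, g^{−θ}}` on `g`. -/
noncomputable def contractedBracketTheta {g : Type*} [LieRing g] [LieAlgebra ℝ g]
    (θ : g ≃ₗ⁅ℝ⁆ g) (X Y : g) : g :=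
  ⁅prTheta θ X, prTheta θ Y⁆ + prThetaMinus θ ⁅prTheta θ X, prThetaMinus θ Y⁆
    + prThetaMinus θ ⁅prThetaMinus θ X, prTheta θ Y⁆

section SymmetricDecomposition

variable {R L : Type*} [CommRing R] [LieRing L] [LieAlgebra R L]

/-- `K` and `P` are the projections of a Lie algebra `L` onto the two summands of a
`ℤ/2`-grading `L = k ⊕ p`. -/
structure IsSymmetricDecomposition (K P : L →ₗ[R] L) : Prop where
  add_apply : ∀ x, K x + P x = x
  idem : ∀ x, K (K x) = K x
  snd_lie_fst_fst : ∀ x y, P ⁅K x, K y⁆ = 0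
  snd_lie_snd_snd : ∀ x y, P ⁅P x, P y⁆ = 0
  fst_lie_fst_snd : ∀ x y, K ⁅K x, P y⁆ = 0

/-- The bracket obtained by rescaling by `c` the bracket of two elements of the odd part. -/
def scaledBracket (K P : L →ₗ[R] L) (c : R) (x y : L) : L :=
  ⁅K x, K y⁆ + ⁅K x, P y⁆ + ⁅P x, K y⁆ + c • ⁅P x, P y⁆

theorem scaledBracket_smul (K P : L →ₗ[R] L) (c t : R) (x y : L) :
    scaledBracket K P c x (t • y) = t • scaledBracket K P c x y := by
  simp only [scaledBracket, map_smul, lie_smul, smul_add, smul_comm c t]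

namespace IsSymmetricDecomposition

variable {K P : L →ₗ[R] L} (h : IsSymmetricDecomposition K P)
include h

theorem fst_snd (x : L) : K (P x) = 0 := by
  have := congrArg K (h.add_apply x)
  rwa [map_add, h.idem, add_eq_left] at this

theorem snd_fst (x : L) : P (K x) = 0 := by
  have := h.add_apply (K x)
  rwa [h.idem, add_eq_left] at this

theorem snd_snd (x : L) : P (P x) = P x := by
  have := h.add_apply (P x)
  rwa [h.fst_snd, zero_add] at this

theorem fst_lie_snd_fst (x y : L) : K ⁅P x, K y⁆ = 0 := by
  rw [← lie_skew, map_neg, h.fst_lie_fst_snd, neg_zero]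

theorem fst_eq_of_snd_eq_zero {x : L} (hx : P x = 0) : K x = x := by
  simpa [hx] using h.add_apply x

theorem snd_eq_of_fst_eq_zero {x : L} (hx : K x = 0) : P x = x := by
  simpa [hx] using h.add_apply x

theorem fst_scaledBracket (c : R) (x y : L) :
    K (scaledBracket K P c x y) = ⁅K x, K y⁆ + c • ⁅P x, P y⁆ := by
  simp [scaledBracket, h.fst_lie_fst_snd, h.fst_lie_snd_fst,
    h.fst_eq_of_snd_eq_zero (h.snd_lie_fst_fst x y),
    h.fst_eq_of_snd_eq_zero (h.snd_lie_snd_snd x y)]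

theorem snd_scaledBracket (c : R) (x y : L) :
    P (scaledBracket K P c x y) = ⁅K x, P y⁆ + ⁅P x, K y⁆ := by
  simp [scaledBracket, h.snd_lie_fst_fst, h.snd_lie_snd_snd,
    h.snd_eq_of_fst_eq_zero (h.fst_lie_fst_snd x y),
    h.snd_eq_of_fst_eq_zero (h.fst_lie_snd_fst x y)]

/-- The Lie ring structure given by the scaled bracket. -/
abbrev scaledLieRing (c : R) : LieRing L where
  bracket := scaledBracket K P c
  add_lie x y z := by simp only [scaledBracket, map_add]; simp; abel
  lie_add x y z := by simp only [scaledBracket, map_add]; simp; abel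
  lie_self x := by
    change scaledBracket K P c x x = 0
    rw [scaledBracket, lie_self, lie_self, ← lie_skew (K x) (P x), smul_zero]
    abel
  leibniz_lie x y z := by
    change scaledBracket K P c x (scaledBracket K P c y z) =
      scaledBracket K P c (scaledBracket K P c x y) z +
        scaledBracket K P c y (scaledBracket K P c x z)
    rw [scaledBracket, scaledBracket.eq_def K P c (scaledBracket K P c x y),
      scaledBracket.eq_def K P c y (scaledBracket K P c x z)]
    simp only [h.fst_scaledBracket, h.snd_scaledBracket, lie_add, add_lie, lie_smul, smul_lie,
      smul_add]
    rw [leibniz_lie (K x) (K y) (K z), leibniz_lie (K x) (P y) (P z),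
      leibniz_lie (K x) (K y) (P z), leibniz_lie (K x) (P y) (K z),
      leibniz_lie (P x) (K y) (K z), leibniz_lie (P x) (P y) (P z),
      leibniz_lie (P x) (K y) (P z), leibniz_lie (P x) (P y) (K z)]
    simp only [smul_add]
    abel

/-- The scaled bracket is bilinear. -/
abbrev scaledLieAlgebra (c : R) : @LieAlgebra R L _ (h.scaledLieRing c) :=
  @LieAlgebra.mk R L _ (h.scaledLieRing c) LieAlgebra.toModule (scaledBracket_smul K P c)

theorem baseChange (A : Type*) [CommRing A] [Algebra R A] :
    IsSymmetricDecomposition (K.baseChange A) (P.baseChange A) where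
  add_apply x := by
    rw [← LinearMap.add_apply, ← LinearMap.baseChange_add,
      show K + P = LinearMap.id from LinearMap.ext h.add_apply, LinearMap.baseChange_id,
      LinearMap.id_apply]
  idem x := by
    rw [← LinearMap.comp_apply, ← LinearMap.baseChange_comp,
      show K ∘ₗ K = K from LinearMap.ext h.idem]
  snd_lie_fst_fst x y := by
    induction x with
    | zero => simp
    | add x₁ x₂ h₁ h₂ => simp [h₁, h₂]
    | tmul a v =>
      induction y with
      | zero => simp
      | add y₁ y₂ h₁ h₂ => simp only [map_add, lie_add, h₁, h₂, add_zero]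
      | tmul b w => simp [h.snd_lie_fst_fst]
  snd_lie_snd_snd x y := by
    induction x with
    | zero => simp
    | add x₁ x₂ h₁ h₂ => simp [h₁, h₂]
    | tmul a v =>
      induction y with
      | zero => simp
      | add y₁ y₂ h₁ h₂ => simp only [map_add, lie_add, h₁, h₂, add_zero]
      | tmul b w => simp [h.snd_lie_snd_snd]
  fst_lie_fst_snd x y := by
    induction x with
    | zero => simp
    | add x₁ x₂ h₁ h₂ => simp [h₁, h₂]
    | tmul a v =>
      induction y with
      | zero => simp
      | add y₁ y₂ h₁ h₂ => simp only [map_add, lie_add, h₁, h₂, add_zero]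
      | tmul b w => simp [h.fst_lie_fst_snd]

end IsSymmetricDecomposition

theorem prTheta_apply {g : Type*} [LieRing g] [LieAlgebra ℝ g] (θ : g ≃ₗ⁅ℝ⁆ g) (x : g) :
    prTheta θ x = (1 / 2 : ℝ) • (x + θ x) := rfl

theorem prThetaMinus_apply {g : Type*} [LieRing g] [LieAlgebra ℝ g] (θ : g ≃ₗ⁅ℝ⁆ g) (x : g) :
    prThetaMinus θ x = (1 / 2 : ℝ) • (x - θ x) := rfl

theorem isSymmetricDecomposition_prTheta {g : Type*} [LieRing g] [LieAlgebra ℝ g]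
    (θ : g ≃ₗ⁅ℝ⁆ g) (hθ : ∀ x, θ (θ x) = x) :
    IsSymmetricDecomposition (prTheta θ) (prThetaMinus θ) where
  add_apply x := by simp only [prTheta_apply, prThetaMinus_apply]; module
  idem x := by simp only [prTheta_apply, map_smul, map_add, hθ]; module
  snd_lie_fst_fst x y := by
    simp only [prTheta_apply, prThetaMinus_apply, map_smul, map_add, hθ, LieEquiv.map_lie,
      smul_lie, lie_smul, add_lie, lie_add]
    module
  snd_lie_snd_snd x y := by
    simp only [prThetaMinus_apply, map_smul, map_sub, hθ, LieEquiv.map_lie, smul_lie, lie_smul,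
      sub_lie, lie_sub]
    module
  fst_lie_fst_snd x y := by
    simp only [prTheta_apply, prThetaMinus_apply, map_smul, map_sub, map_add, hθ,
      LieEquiv.map_lie, smul_lie, lie_smul, lie_sub, add_lie]
    module

theorem contractedBracketTheta_eq_scaledBracket {g : Type*} [LieRing g] [LieAlgebra ℝ g]
    (θ : g ≃ₗ⁅ℝ⁆ g) (hθ : ∀ x, θ (θ x) = x) (x y : g) :
    contractedBracketTheta θ x y = scaledBracket (prTheta θ) (prThetaMinus θ) (0 : ℝ) x y := by
  have h := isSymmetricDecomposition_prTheta θ hθ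
  rw [contractedBracketTheta, scaledBracket, zero_smul, add_zero,
    h.snd_eq_of_fst_eq_zero (h.fst_lie_fst_snd x y),
    h.snd_eq_of_fst_eq_zero (h.fst_lie_snd_fst x y)]

end SymmetricDecomposition

theorem exists_lieEquiv_type (g : Type*) [LieRing g] [LieAlgebra ℝ g] [FiniteDimensional ℝ g] :
    ∃ (h : Type) (_ : LieRing h) (_ : LieAlgebra ℝ h), Nonempty (h ≃ₗ⁅ℝ⁆ g) := by
  let e := ((Module.finBasis ℝ g).equivFun.symm : _ ≃ₗ[ℝ] g).toEquiv
  exact ⟨_, e.lieRing, e.lieAlgebra ℝ, ⟨e.lieEquiv ℝ⟩⟩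

section ContractForm

variable {A h : Type*} [CommRing A] [Algebra ℝ A] [LieRing h] [LieAlgebra ℝ h]

variable (h) in
/-- The map `A ⊗ h → h` induced by an `ℝ`-linear form on `A`. -/
noncomputable def contractForm (ℓ : A →ₗ[ℝ] ℝ) : A ⊗[ℝ] h →ₗ[ℝ] h :=
  TensorProduct.lid ℝ h ∘ₗ ℓ.rTensor h

@[simp]
theorem contractForm_tmul (ℓ : A →ₗ[ℝ] ℝ) (a : A) (v : h) :
    contractForm h ℓ (a ⊗ₜ v) = ℓ a • v := by
  simp [contractForm]

theorem contractForm_lie {ℓ₁ ℓ₂ : A →ₗ[ℝ] ℝ}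
    (hℓ : ∀ a b, ℓ₁ (a * b) = ℓ₁ a * ℓ₁ b - ℓ₂ a * ℓ₂ b) (x y : A ⊗[ℝ] h) :
    contractForm h ℓ₁ ⁅x, y⁆ =
      ⁅contractForm h ℓ₁ x, contractForm h ℓ₁ y⁆ -
        ⁅contractForm h ℓ₂ x, contractForm h ℓ₂ y⁆ := by
  induction x with
  | zero => simp
  | add x₁ x₂ h₁ h₂ => simp only [map_add, add_lie, h₁, h₂]; abel
  | tmul a v =>
    induction y with
    | zero => simp
    | add y₁ y₂ h₁ h₂ => simp only [map_add, lie_add, h₁, h₂]; abel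
    | tmul b w =>
      simp only [LieAlgebra.ExtendScalars.bracket_tmul, contractForm_tmul, hℓ, smul_lie, lie_smul]
      module

end ContractForm

section PolynomialFamily

variable {h : Type*} [LieRing h] [LieAlgebra ℝ h]

/-- Complex conjugation of the coefficients of a polynomial. -/
noncomputable def polyConj : ℂ[X] →ₐ[ℝ] ℂ[X] :=
  mapAlgHom Complex.conjAe.toAlgHom

theorem polyConj_apply (f : ℂ[X]) : polyConj f = f.map (starRingEnd ℂ) := rfl

theorem polyConj_polyConj (f : ℂ[X]) : polyConj (polyConj f) = f := by
  simp [polyConj_apply, Polynomial.map_map]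

theorem eval_polyConj (α : ℝ) (f : ℂ[X]) :
    (polyConj f).eval (α : ℂ) = starRingEnd ℂ (f.eval (α : ℂ)) := by
  conv_lhs => rw [polyConj_apply, ← Complex.conj_ofReal α]
  exact eval_map_apply (starRingEnd ℂ) (α : ℂ)

variable (h) in
/-- Conjugation of the polynomial coefficients on `ℂ[z] ⊗ h`. -/
noncomputable def familyConj : ℂ[X] ⊗[ℝ] h →ₗ[ℝ] ℂ[X] ⊗[ℝ] h :=
  polyConj.toLinearMap.rTensor h

@[simp]
theorem familyConj_tmul (f : ℂ[X]) (v : h) : familyConj h (f ⊗ₜ v) = polyConj f ⊗ₜ v := rfl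

theorem familyConj_familyConj (x : ℂ[X] ⊗[ℝ] h) : familyConj h (familyConj h x) = x := by
  induction x with
  | zero => simp
  | add x y hx hy => simp [hx, hy]
  | tmul f v => simp [polyConj_polyConj]

theorem familyConj_smul (f : ℂ[X]) (x : ℂ[X] ⊗[ℝ] h) :
    familyConj h (f • x) = f.map (starRingEnd ℂ) • familyConj h x := by
  induction x with
  | zero => simp
  | add x y hx hy => simp only [smul_add, map_add, hx, hy]
  | tmul p v => simp [TensorProduct.smul_tmul', ← polyConj_apply]

theorem familyConj_lie (x y : ℂ[X] ⊗[ℝ] h) :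
    familyConj h ⁅x, y⁆ = ⁅familyConj h x, familyConj h y⁆ :=
  (LieAlgebra.ExtendScalars.map polyConj (LieHom.id : h →ₗ⁅ℝ⁆ h)).map_lie x y

theorem familyConj_baseChange (K : h →ₗ[ℝ] h) (x : ℂ[X] ⊗[ℝ] h) :
    familyConj h (K.baseChange ℂ[X] x) = K.baseChange ℂ[X] (familyConj h x) := by
  induction x with
  | zero => simp
  | add x y hx hy => simp [hx, hy]
  | tmul f v => simp

theorem familyConj_scaledBracket (K P : h →ₗ[ℝ] h) (x y : ℂ[X] ⊗[ℝ] h) :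
    familyConj h (scaledBracket (K.baseChange ℂ[X]) (P.baseChange ℂ[X]) X x y) =
      scaledBracket (K.baseChange ℂ[X]) (P.baseChange ℂ[X]) X
        (familyConj h x) (familyConj h y) := by
  simp [scaledBracket, familyConj_smul, familyConj_lie, familyConj_baseChange]

variable (h) in
/-- The value at `α` of an element of `ℂ[z] ⊗ h`, composed with an `ℝ`-linear form `ℓ` on `ℂ`. -/
noncomputable def familyEval (ℓ : ℂ →ₗ[ℝ] ℝ) (α : ℝ) : ℂ[X] ⊗[ℝ] h →ₗ[ℝ] h :=
  contractForm h (ℓ ∘ₗ ((aeval (α : ℂ) : ℂ[X] →ₐ[ℂ] ℂ).restrictScalars ℝ).toLinearMap)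

@[simp]
theorem familyEval_tmul (ℓ : ℂ →ₗ[ℝ] ℝ) (α : ℝ) (f : ℂ[X]) (v : h) :
    familyEval h ℓ α (f ⊗ₜ v) = ℓ (f.eval (α : ℂ)) • v := by
  simp [familyEval, contractForm, coe_aeval_eq_eval]

theorem familyEval_baseChange (ℓ : ℂ →ₗ[ℝ] ℝ) (α : ℝ) (K : h →ₗ[ℝ] h) (x : ℂ[X] ⊗[ℝ] h) :
    familyEval h ℓ α (K.baseChange ℂ[X] x) = K (familyEval h ℓ α x) := by
  induction x with
  | zero => simp
  | add x y hx hy => simp [hx, hy]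
  | tmul f v => simp

theorem familyEval_smul (ℓ : ℂ →ₗ[ℝ] ℝ) (α : ℝ) {f : ℂ[X]} {r : ℝ}
    (hf : f.eval (α : ℂ) = r) (x : ℂ[X] ⊗[ℝ] h) :
    familyEval h ℓ α (f • x) = r • familyEval h ℓ α x := by
  induction x with
  | zero => simp
  | add x y hx hy => simp only [smul_add, map_add, hx, hy]
  | tmul p v =>
    rw [TensorProduct.smul_tmul', smul_eq_mul, familyEval_tmul, familyEval_tmul, eval_mul, hf,
      ← Complex.real_smul, map_smul, smul_assoc]

theorem familyEval_im_familyConj (α : ℝ) (x : ℂ[X] ⊗[ℝ] h) :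
    familyEval h Complex.imLm α (familyConj h x) = -familyEval h Complex.imLm α x := by
  induction x with
  | zero => simp
  | add x y hx hy => simp only [map_add, hx, hy, neg_add]
  | tmul f v => simp [eval_polyConj]

theorem familyEval_im_eq_zero (α : ℝ) {x : ℂ[X] ⊗[ℝ] h} (hx : familyConj h x = x) :
    familyEval h Complex.imLm α x = 0 := by
  have := familyEval_im_familyConj α x
  rw [hx] at this
  have h2 : (2 : ℝ) • familyEval h Complex.imLm α x = 0 := by
    rw [two_smul]; exact add_eq_zero_iff_eq_neg.mpr this
  simpa using h2

theorem familyEval_re_lie (α : ℝ) (x y : ℂ[X] ⊗[ℝ] h) :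
    familyEval h Complex.reLm α ⁅x, y⁆ =
      ⁅familyEval h Complex.reLm α x, familyEval h Complex.reLm α y⁆ -
        ⁅familyEval h Complex.imLm α x, familyEval h Complex.imLm α y⁆ :=
  contractForm_lie (fun a b => by simp [coe_aeval_eq_eval]) x y

theorem familyEval_re_scaledBracket (α : ℝ) (K P : h →ₗ[ℝ] h) {x y : ℂ[X] ⊗[ℝ] h}
    (hx : familyConj h x = x) :
    familyEval h Complex.reLm α (scaledBracket (K.baseChange ℂ[X]) (P.baseChange ℂ[X]) X x y) =
      scaledBracket K P α (familyEval h Complex.reLm α x) (familyEval h Complex.reLm α y) := by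
  simp [scaledBracket, familyEval_smul _ α (eval_X (x := (α : ℂ))), familyEval_re_lie,
    familyEval_baseChange, familyEval_im_eq_zero α hx]

theorem familyConj_one_tmul (v : h) : familyConj h (1 ⊗ₜ v) = 1 ⊗ₜ v := by simp

theorem exists_eq_smul_add (α : ℝ) (x : ℂ[X] ⊗[ℝ] h) :
    ∃ y : ℂ[X] ⊗[ℝ] h, x = (X - C (α : ℂ)) • y + 1 ⊗ₜ familyEval h Complex.reLm α x +
      C Complex.I ⊗ₜ familyEval h Complex.imLm α x := by
  induction x with
  | zero => exact ⟨0, by simp⟩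
  | add x₁ x₂ h₁ h₂ =>
    obtain ⟨y₁, h₁⟩ := h₁
    obtain ⟨y₂, h₂⟩ := h₂
    refine ⟨y₁ + y₂, ?_⟩
    simp only [map_add, smul_add, TensorProduct.tmul_add]
    nth_rw 1 [h₁, h₂]
    abel
  | tmul f v =>
    refine ⟨(f /ₘ (X - C (α : ℂ))) ⊗ₜ v, ?_⟩
    have hf := modByMonic_add_div f (X - C (α : ℂ))
    rw [modByMonic_X_sub_C_eq_C_eval] at hf
    rw [familyEval_tmul, familyEval_tmul, TensorProduct.smul_tmul', ← TensorProduct.smul_tmul,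
      ← TensorProduct.smul_tmul, ← TensorProduct.add_tmul, ← TensorProduct.add_tmul]
    congr 1
    nth_rw 1 [← hf, ← Complex.re_add_im (f.eval (α : ℂ))]
    simp only [Algebra.smul_def, Polynomial.algebraMap_apply, Complex.coe_algebraMap,
      Complex.reLm_coe, Complex.imLm_coe, C_add, C_mul,
      Algebra.algebraMap_self, RingHom.id_apply]
    ring

theorem familyEval_re_eq_zero_iff (α : ℝ) {x : ℂ[X] ⊗[ℝ] h} (hx : familyConj h x = x) :
    familyEval h Complex.reLm α x = 0 ↔
      ∃ y : ℂ[X] ⊗[ℝ] h, familyConj h y = y ∧ x = (X - C (α : ℂ)) • y := by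
  constructor
  · intro h₀
    obtain ⟨y, hy⟩ := exists_eq_smul_add α x
    rw [h₀, familyEval_im_eq_zero α hx] at hy
    simp only [TensorProduct.tmul_zero, add_zero] at hy
    refine ⟨y, ?_, hy⟩
    rw [hy, familyConj_smul] at hx
    refine smul_right_injective _ (X_sub_C_ne_zero (α : ℂ)) ?_
    simpa using hx
  · rintro ⟨y, -, rfl⟩
    rw [familyEval_smul (r := 0) _ α (by simp), zero_smul]

end PolynomialFamily

section Fibers

theorem IsSymmetricDecomposition.map_scaledBracket {R L : Type*} [CommRing R] [LieRing L]
    [LieAlgebra R L] {K P : L →ₗ[R] L} (h : IsSymmetricDecomposition K P) {c s : R}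
    (hs : s * s = c) (x y : L) :
    (K + s • P) (scaledBracket K P c x y) = ⁅(K + s • P) x, (K + s • P) y⁆ := by
  simp only [LinearMap.add_apply, LinearMap.smul_apply, h.fst_scaledBracket, h.snd_scaledBracket,
    lie_add, add_lie, lie_smul, smul_lie, ← hs, mul_smul, smul_add]
  abel

/-- The map `x ↦ 1 ⊗ K x + s ⊗ P x` into an extension of scalars of `L`. -/
noncomputable def tensorEmbedding {R L A : Type*} [CommRing R] [LieRing L] [LieAlgebra R L]
    [CommRing A] [Algebra R A] (K P : L →ₗ[R] L) (s : A) : L →ₗ[R] A ⊗[R] L :=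
  TensorProduct.mk R A L 1 ∘ₗ K + TensorProduct.mk R A L s ∘ₗ P

theorem tensorEmbedding_apply {R L A : Type*} [CommRing R] [LieRing L] [LieAlgebra R L]
    [CommRing A] [Algebra R A] (K P : L →ₗ[R] L) (s : A) (x : L) :
    tensorEmbedding K P s x = 1 ⊗ₜ K x + s ⊗ₜ P x := rfl

theorem IsSymmetricDecomposition.tensorEmbedding_scaledBracket {R L A : Type*} [CommRing R]
    [LieRing L] [LieAlgebra R L] [CommRing A] [Algebra R A] {K P : L →ₗ[R] L}
    (h : IsSymmetricDecomposition K P) {c : R} {s : A} (hs : s * s = algebraMap R A c) (x y : L) :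
    tensorEmbedding K P s (scaledBracket K P c x y) =
      ⁅tensorEmbedding K P s x, tensorEmbedding K P s y⁆ := by
  simp only [tensorEmbedding_apply, h.fst_scaledBracket, h.snd_scaledBracket, lie_add, add_lie,
    LieAlgebra.ExtendScalars.bracket_tmul, one_mul, mul_one, hs, TensorProduct.tmul_add,
    Algebra.algebraMap_eq_smul_one, TensorProduct.smul_tmul]
  abel

theorem eq_one_tmul_add_I_tmul {g : Type*} [LieRing g] [LieAlgebra ℝ g] (z : ℂ ⊗[ℝ] g) :
    z = 1 ⊗ₜ contractForm g Complex.reLm z + Complex.I ⊗ₜ contractForm g Complex.imLm z := by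
  induction z with
  | zero => simp
  | add x y hx hy =>
    nth_rw 1 [hx, hy]
    simp only [map_add, TensorProduct.tmul_add]
    abel
  | tmul a v =>
    rw [contractForm_tmul, contractForm_tmul, ← TensorProduct.smul_tmul,
      ← TensorProduct.smul_tmul, ← TensorProduct.add_tmul]
    congr 1
    apply Complex.ext <;> simp

section DualForm

variable {g : Type*} [LieRing g] [LieAlgebra ℝ g] (θ : g ≃ₗ⁅ℝ⁆ g)

theorem contractForm_re_sigmaC_thetaC (z : ℂ ⊗[ℝ] g) :
    contractForm g Complex.reLm (sigmaC g (thetaC θ z)) = θ (contractForm g Complex.reLm z) := by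
  induction z with
  | zero => simp
  | add x y hx hy => simp only [map_add, hx, hy]
  | tmul a v => simp [sigmaC, thetaC]

theorem contractForm_im_sigmaC_thetaC (z : ℂ ⊗[ℝ] g) :
    contractForm g Complex.imLm (sigmaC g (thetaC θ z)) = -θ (contractForm g Complex.imLm z) := by
  induction z with
  | zero => simp
  | add x y hx hy => simp only [map_add, hx, hy, neg_add]
  | tmul a v => simp [sigmaC, thetaC]

theorem contractForm_re_tensorEmbedding (K P : g →ₗ[ℝ] g) (s : ℝ) (x : g) :
    contractForm g Complex.reLm (tensorEmbedding K P (s * Complex.I) x) = K x := by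
  simp [tensorEmbedding_apply]

theorem contractForm_im_tensorEmbedding (K P : g →ₗ[ℝ] g) (s : ℝ) (x : g) :
    contractForm g Complex.imLm (tensorEmbedding K P (s * Complex.I) x) = s • P x := by
  simp [tensorEmbedding_apply]

theorem IsSymmetricDecomposition.tensorEmbedding_injective {K P : g →ₗ[ℝ] g}
    (h : IsSymmetricDecomposition K P) {s : ℝ} (hs : s ≠ 0) :
    Function.Injective (tensorEmbedding K P (s * Complex.I)) := by
  refine (injective_iff_map_eq_zero _).mpr fun x hx => ?_
  have hK := contractForm_re_tensorEmbedding K P s x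
  have hP := contractForm_im_tensorEmbedding K P s x
  rw [hx, map_zero] at hK hP
  rw [← h.add_apply x, ← hK, (smul_eq_zero_iff_right hs).mp hP.symm, add_zero]

theorem IsSymmetricDecomposition.add_smul_bijective {K P : g →ₗ[ℝ] g}
    (h : IsSymmetricDecomposition K P) {s : ℝ} (hs : s ≠ 0) :
    Function.Bijective (K + s • P) := by
  refine Function.bijective_iff_has_inverse.mpr ⟨K + s⁻¹ • P, fun x => ?_, fun x => ?_⟩ <;>
  simp [h.idem, h.fst_snd, h.snd_fst, h.snd_snd, h.add_apply, smul_smul, hs]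

theorem range_tensorEmbedding_prTheta (hθ : ∀ x, θ (θ x) = x) {s : ℝ} (hs : s ≠ 0) :
    Set.range (tensorEmbedding (prTheta θ) (prThetaMinus θ) (s * Complex.I)) =
      {z : ℂ ⊗[ℝ] g | sigmaC g (thetaC θ z) = z} := by
  have h := isSymmetricDecomposition_prTheta θ hθ
  ext z
  constructor
  · rintro ⟨x, rfl⟩
    change sigmaC g (thetaC θ _) = _
    have hK : θ (prTheta θ x) = prTheta θ x := by
      simp only [prTheta_apply, map_smul, map_add, hθ, add_comm]
    have hP : θ (prThetaMinus θ x) = -prThetaMinus θ x := by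
      simp only [prThetaMinus_apply, map_smul, map_sub, hθ, ← smul_neg, neg_sub]
    rw [eq_one_tmul_add_I_tmul (sigmaC g _), contractForm_re_sigmaC_thetaC,
      contractForm_im_sigmaC_thetaC, contractForm_re_tensorEmbedding,
      contractForm_im_tensorEmbedding, map_smul, hK, hP, smul_neg, neg_neg,
      ← contractForm_re_tensorEmbedding (prTheta θ) (prThetaMinus θ) s,
      ← contractForm_im_tensorEmbedding (prTheta θ) (prThetaMinus θ) s,
      ← eq_one_tmul_add_I_tmul]
  · intro hz
    change sigmaC g (thetaC θ z) = z at hz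
    have hre := contractForm_re_sigmaC_thetaC θ z
    have him := contractForm_im_sigmaC_thetaC θ z
    rw [hz] at hre him
    have hK : prThetaMinus θ (contractForm g Complex.reLm z) = 0 := by
      rw [prThetaMinus_apply, ← hre, sub_self, smul_zero]
    have hP : prTheta θ (contractForm g Complex.imLm z) = 0 := by
      rw [prTheta_apply, add_eq_zero_iff_eq_neg.mpr him, smul_zero]
    refine ⟨contractForm g Complex.reLm z + s⁻¹ • contractForm g Complex.imLm z, ?_⟩
    rw [eq_one_tmul_add_I_tmul (tensorEmbedding _ _ _ _), contractForm_re_tensorEmbedding,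
      contractForm_im_tensorEmbedding, map_add, map_add, map_smul, map_smul, hK, hP,
      h.fst_eq_of_snd_eq_zero hK, h.snd_eq_of_fst_eq_zero hP, smul_zero, add_zero, zero_add,
      smul_inv_smul₀ hs, ← eq_one_tmul_add_I_tmul]

end DualForm

theorem map_scaledBracket_prTheta_conj {g h : Type*} [LieRing g] [LieAlgebra ℝ g]
    [LieRing h] [LieAlgebra ℝ h] (θ : g ≃ₗ⁅ℝ⁆ g) (e : h ≃ₗ⁅ℝ⁆ g) (c : ℝ) (x y : h) :
    e (scaledBracket (prTheta ((e.trans θ).trans e.symm))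
        (prThetaMinus ((e.trans θ).trans e.symm)) c x y) =
      scaledBracket (prTheta θ) (prThetaMinus θ) c (e x) (e y) := by
  simp [scaledBracket, prTheta_apply, prThetaMinus_apply, LieEquiv.map_lie]

/-- The family over the affine line obtained by rescaling by the coordinate `z` the bracket of
two elements of the odd part of a symmetric Lie algebra. -/
noncomputable def contractionFamily {h : Type} [LieRing h] [LieAlgebra ℝ h]
    [FiniteDimensional ℝ h] {K P : h →ₗ[ℝ] h} (hKP : IsSymmetricDecomposition K P) :
    AlgebraicFamilyOfComplexLieAlgebras where
  carrier := ℂ[X] ⊗[ℝ] h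
  lieRing := (hKP.baseChange ℂ[X]).scaledLieRing X
  lieAlgebra := (hKP.baseChange ℂ[X]).scaledLieAlgebra X
  free := inferInstanceAs (Module.Free ℂ[X] (ℂ[X] ⊗[ℝ] h))
  finite := inferInstanceAs (Module.Finite ℂ[X] (ℂ[X] ⊗[ℝ] h))

section Family

variable {h V : Type*} [LieRing h] [LieAlgebra ℝ h] [AddCommGroup V] [Module ℝ V]

theorem map_familyEval_re_C_smul (T : h →ₗ[ℝ] V) (α r : ℝ) (x : ℂ[X] ⊗[ℝ] h) :
    T (familyEval h Complex.reLm α (C (r : ℂ) • x)) = r • T (familyEval h Complex.reLm α x) := by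
  rw [familyEval_smul _ _ eval_C, map_smul]

theorem map_familyEval_re_eq_zero_iff {T : h →ₗ[ℝ] V} (hT : Function.Injective T) (α : ℝ)
    {x : ℂ[X] ⊗[ℝ] h} (hx : familyConj h x = x) :
    T (familyEval h Complex.reLm α x) = 0 ↔
      ∃ y : ℂ[X] ⊗[ℝ] h, familyConj h y = y ∧ x = (X - C (α : ℂ)) • y := by
  rw [map_eq_zero_iff T hT, familyEval_re_eq_zero_iff α hx]

theorem image_map_familyEval_re (T : h →ₗ[ℝ] V) (α : ℝ) :
    (fun x => T (familyEval h Complex.reLm α x)) '' {x | familyConj h x = x} = Set.range T := by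
  ext v
  constructor
  · rintro ⟨x, -, rfl⟩
    exact ⟨_, rfl⟩
  · rintro ⟨w, rfl⟩
    exact ⟨1 ⊗ₜ w, familyConj_one_tmul w, by simp⟩

end Family

end Fibers

/-- For a real symmetric Lie algebra `(g, θ)` with dual real form
`g* = {Z ∈ g(ℂ) : σ*(Z) = Z}`, there exist an algebraic family of complex Lie
algebras `𝔤` over the affine line and an anti-holomorphic involution `σ̂` of `𝔤` such
that the fiber of the family of real Lie algebras `𝔤^σ̂ = {X : σ̂ X = X}` at `α ∈ ℝ`
(the quotient of `𝔤^σ̂` by `(z−α)•𝔤^σ̂`, presented here by a surjection `φ` whose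
kernel on `𝔤^σ̂` is exactly `(z−α)•𝔤^σ̂`) is isomorphic to `g*` for `α < 0`, to the
Inönü–Wigner contraction `(g, [·,·]₀^{g^θ,g^{−θ}})` for `α = 0`, and to `g` for
`α > 0`. -/
theorem dual_contractions_in_one_algebraic_family
    (g : Type*) [LieRing g] [LieAlgebra ℝ g] [FiniteDimensional ℝ g]
    (θ : g ≃ₗ⁅ℝ⁆ g) (hθ : ∀ X : g, θ (θ X) = X)
    (gstar : Set (ℂ ⊗[ℝ] g))
    (hgstar : gstar = {z : ℂ ⊗[ℝ] g | sigmaC g (thetaC θ z) = z}) :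
    ∃ (𝔉 : AlgebraicFamilyOfComplexLieAlgebras)
      (σ : 𝔉.carrier → 𝔉.carrier),
      (∀ X Y : 𝔉.carrier, σ (X + Y) = σ X + σ Y) ∧
      (∀ X : 𝔉.carrier, σ (σ X) = X) ∧
      (∀ X Y : 𝔉.carrier, σ ⁅X, Y⁆ = ⁅σ X, σ Y⁆) ∧
      (∀ (f : Polynomial ℂ) (X : 𝔉.carrier),
        σ (f • X) = (f.map (starRingEnd ℂ)) • σ X) ∧
      (∀ X ∈ {X : 𝔉.carrier | σ X = X}, ∀ Y ∈ {X : 𝔉.carrier | σ X = X},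
        ⁅X, Y⁆ ∈ {X : 𝔉.carrier | σ X = X}) ∧
      -- the fiber at `α > 0` is isomorphic to `g`
      (∀ α : ℝ, 0 < α →
        ∃ φ : 𝔉.carrier → g,
          (∀ X ∈ {X : 𝔉.carrier | σ X = X}, ∀ Y ∈ {X : 𝔉.carrier | σ X = X},
            φ (X + Y) = φ X + φ Y) ∧
          (∀ (r : ℝ), ∀ X ∈ {X : 𝔉.carrier | σ X = X},
            φ ((Polynomial.C (r : ℂ)) • X) = r • φ X) ∧
          (∀ X ∈ {X : 𝔉.carrier | σ X = X}, ∀ Y ∈ {X : 𝔉.carrier | σ X = X},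
            φ ⁅X, Y⁆ = ⁅φ X, φ Y⁆) ∧
          (∀ t : g, ∃ X ∈ {X : 𝔉.carrier | σ X = X}, φ X = t) ∧
          (∀ X ∈ {X : 𝔉.carrier | σ X = X}, (φ X = 0 ↔
            ∃ Y ∈ {X : 𝔉.carrier | σ X = X},
              X = (Polynomial.X - Polynomial.C (α : ℂ)) • Y))) ∧
      -- the fiber at `α = 0` is isomorphic to the contraction `g^θ ⋉ g^{−θ}`
      (∃ φ : 𝔉.carrier → g,
          (∀ X ∈ {X : 𝔉.carrier | σ X = X}, ∀ Y ∈ {X : 𝔉.carrier | σ X = X},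
            φ (X + Y) = φ X + φ Y) ∧
          (∀ (r : ℝ), ∀ X ∈ {X : 𝔉.carrier | σ X = X},
            φ ((Polynomial.C (r : ℂ)) • X) = r • φ X) ∧
          (∀ X ∈ {X : 𝔉.carrier | σ X = X}, ∀ Y ∈ {X : 𝔉.carrier | σ X = X},
            φ ⁅X, Y⁆ = contractedBracketTheta θ (φ X) (φ Y)) ∧
          (∀ t : g, ∃ X ∈ {X : 𝔉.carrier | σ X = X}, φ X = t) ∧
          (∀ X ∈ {X : 𝔉.carrier | σ X = X}, (φ X = 0 ↔
            ∃ Y ∈ {X : 𝔉.carrier | σ X = X},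
              X = (Polynomial.X - Polynomial.C (0 : ℂ)) • Y))) ∧
      -- the fiber at `α < 0` is isomorphic to the dual real form `g*`
      (∀ α : ℝ, α < 0 →
        ∃ φ : 𝔉.carrier → (ℂ ⊗[ℝ] g),
          (∀ X ∈ {X : 𝔉.carrier | σ X = X}, ∀ Y ∈ {X : 𝔉.carrier | σ X = X},
            φ (X + Y) = φ X + φ Y) ∧
          (∀ (r : ℝ), ∀ X ∈ {X : 𝔉.carrier | σ X = X},
            φ ((Polynomial.C (r : ℂ)) • X) = r • φ X) ∧
          (∀ X ∈ {X : 𝔉.carrier | σ X = X}, ∀ Y ∈ {X : 𝔉.carrier | σ X = X},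
            φ ⁅X, Y⁆ = ⁅φ X, φ Y⁆) ∧
          (φ '' {X : 𝔉.carrier | σ X = X} = gstar) ∧
          (∀ X ∈ {X : 𝔉.carrier | σ X = X}, (φ X = 0 ↔
            ∃ Y ∈ {X : 𝔉.carrier | σ X = X},
              X = (Polynomial.X - Polynomial.C (α : ℂ)) • Y))) := by
  subst hgstar
  obtain ⟨h, _, _, ⟨e⟩⟩ := exists_lieEquiv_type g
  have : FiniteDimensional ℝ h := e.toLinearEquiv.symm.finiteDimensional
  have hg := isSymmetricDecomposition_prTheta θ hθ
  have hh := isSymmetricDecomposition_prTheta ((e.trans θ).trans e.symm) (by simp [hθ])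
  let E : h →ₗ[ℝ] g := e.toLinearEquiv.toLinearMap
  have hE : Function.Bijective E := e.toLinearEquiv.bijective
  have hconj : ∀ x y, familyConj h (scaledBracket _ _ X x y) = scaledBracket _ _ X _ _ :=
    familyConj_scaledBracket (prTheta ((e.trans θ).trans e.symm))
      (prThetaMinus ((e.trans θ).trans e.symm))
  have hev (α : ℝ) (x : ℂ[X] ⊗[ℝ] h) (hx : familyConj h x = x) (y : ℂ[X] ⊗[ℝ] h) :=
    (congrArg e (familyEval_re_scaledBracket α (prTheta ((e.trans θ).trans e.symm))
      (prThetaMinus ((e.trans θ).trans e.symm)) (y := y) hx)).trans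
      (map_scaledBracket_prTheta_conj θ e α _ _)
  refine ⟨contractionFamily hh, familyConj h, map_add _, familyConj_familyConj, hconj,
    familyConj_smul, ?_, ?_, ?_, ?_⟩
  · intro x hx y hy
    exact (hconj x y).trans (congrArg₂ (scaledBracket _ _ X) hx hy)
  · intro α hα
    have hs : Real.sqrt α ≠ 0 := (Real.sqrt_pos.mpr hα).ne'
    have hT := hg.add_smul_bijective hs
    let T := (prTheta θ + Real.sqrt α • prThetaMinus θ) ∘ₗ E
    refine ⟨fun x => T (familyEval h Complex.reLm α x), fun x _ y _ => ?_,
      fun r x _ => map_familyEval_re_C_smul T α r x, fun x hx y _ => ?_, fun t => ?_,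
      fun x hx => map_familyEval_re_eq_zero_iff (hT.comp hE).injective α hx⟩
    · exact map_add (T ∘ₗ familyEval h Complex.reLm α) x y
    · exact (congrArg (prTheta θ + Real.sqrt α • prThetaMinus θ) (hev α x hx y)).trans
        (hg.map_scaledBracket (Real.mul_self_sqrt hα.le) _ _)
    · exact (image_map_familyEval_re T α).ge ((hT.comp hE).surjective t)
  · refine ⟨fun x => E (familyEval h Complex.reLm 0 x), fun x _ y _ => ?_,
      fun r x _ => map_familyEval_re_C_smul E 0 r x, fun x hx y _ => ?_, fun t => ?_,
      fun x hx => ?_⟩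
    · exact map_add (E ∘ₗ familyEval h Complex.reLm 0) x y
    · exact (hev 0 x hx y).trans (contractedBracketTheta_eq_scaledBracket θ hθ _ _).symm
    · exact (image_map_familyEval_re E 0).ge (hE.surjective t)
    · have := map_familyEval_re_eq_zero_iff hE.injective 0 hx
      rwa [Complex.ofReal_zero] at this
  · intro α hα
    have hs : Real.sqrt (-α) ≠ 0 := (Real.sqrt_pos.mpr (neg_pos.mpr hα)).ne'
    have hsq : (Real.sqrt (-α) * Complex.I : ℂ) * (Real.sqrt (-α) * Complex.I) =
        algebraMap ℝ ℂ α := by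
      rw [mul_mul_mul_comm, Complex.I_mul_I, ← Complex.ofReal_mul,
        Real.mul_self_sqrt (neg_pos.mpr hα).le]
      simp
    let T₀ := tensorEmbedding (prTheta θ) (prThetaMinus θ) (Real.sqrt (-α) * Complex.I : ℂ)
    have hT : Function.Injective T₀ := hg.tensorEmbedding_injective hs
    let T := T₀ ∘ₗ E
    have hTE : Function.Injective T := hT.comp hE.injective
    refine ⟨fun x => T (familyEval h Complex.reLm α x), fun x _ y _ => ?_,
      fun r x _ => map_familyEval_re_C_smul T α r x, fun x hx y _ => ?_, ?_,
      fun x hx => map_familyEval_re_eq_zero_iff hTE α hx⟩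
    · exact map_add (T ∘ₗ familyEval h Complex.reLm α) x y
    · exact (congrArg T₀ (hev α x hx y)).trans (hg.tensorEmbedding_scaledBracket hsq _ _)
    · exact ((image_map_familyEval_re T α).trans (hE.surjective.range_comp T₀)).trans
        (range_tensorEmbedding_prTheta θ hθ hs)
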